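/- Fix an activation pattern z'. A point x ∈ ℝ^{n₀} admits vectors g^l, h^l ∈ ℝ^{n_l} (with h⁰ = x) satisfying the constraints g^l = W^l h^{l−1} + b^l, h^l_i = g^l_i whenever z'^l_i = 1, g^l_i ≤ 0 and h^l_i = 0 whenever z'^l_i = 0, and h^l_i ≥ 0, if and only if x belongs to the linear region R_{z'}. In that case the values g^l, h^l are uniquely determined (they equal the gated network values) and the objective W^{L+1} h^L + b^{L+1} equals f_{z'}(x), which equals f(x). Hence the LP obtained by fixing z = z' in the MILP optimizes f over X ∩ R_{z'}. -/

import Mathlib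

open Matrix

/-- A ReLU network with input dimension `n 0`, hidden layer widths `n 1, …, n L`
(layer `l+1` has weights `W l : Matrix (Fin (n (l+1))) (Fin (n l)) ℝ` and bias `b l`),
and an output layer with weight row vector `wOut` and bias `bOut`. -/
structure ReLUNet (n : ℕ → ℕ) (L : ℕ) where
  W : ∀ l : ℕ, Matrix (Fin (n (l + 1))) (Fin (n l)) ℝ
  b : ∀ l : ℕ, Fin (n (l + 1)) → ℝ
  wOut : Fin (n L) → ℝ
  bOut : ℝ

namespace ReLUNet

variable {n : ℕ → ℕ} {L : ℕ}

/-- ReLU layer outputs `h^l` on input `x` (`h^0 = x`). -/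
def hout (N : ReLUNet n L) (x : Fin (n 0) → ℝ) : (l : ℕ) → Fin (n l) → ℝ
  | 0 => x
  | l + 1 => fun i => max 0 (N.W l i ⬝ᵥ N.hout x l + N.b l i)

/-- Preactivation `g^{l+1}_i(x)` of hidden layer `l+1` (for `l < L`). -/
def gact (N : ReLUNet n L) (x : Fin (n 0) → ℝ) (l : ℕ) (i : Fin (n (l + 1))) : ℝ :=
  N.W l i ⬝ᵥ N.hout x l + N.b l i

/-- Network output `f(x) = W^{L+1} h^L + b^{L+1}`. -/
def f (N : ReLUNet n L) (x : Fin (n 0) → ℝ) : ℝ :=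
  N.wOut ⬝ᵥ N.hout x L + N.bOut

/-- An activation pattern: one Boolean `z^{l+1}_i` per hidden neuron. -/
def Pattern (n : ℕ → ℕ) (L : ℕ) : Type :=
  ∀ l : Fin L, Fin (n (l.val + 1)) → Bool

/-- Extension of a pattern to all natural layer indices (irrelevant above `L`). -/
def patExt (z : Pattern n L) (l : ℕ) (i : Fin (n (l + 1))) : Bool :=
  if h : l < L then z ⟨l, h⟩ i else true

/-- Gated layer outputs `ĥ^l`: `ĥ^{l+1}_i = z^{l+1}_i · ĝ^{l+1}_i`. -/
def hgate (N : ReLUNet n L) (z : Pattern n L) (x : Fin (n 0) → ℝ) :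
    (l : ℕ) → Fin (n l) → ℝ
  | 0 => x
  | l + 1 => fun i =>
      if patExt z l i then N.W l i ⬝ᵥ N.hgate z x l + N.b l i else 0

/-- Gated preactivation `ĝ^{l+1}_i(x)`. -/
def ggate (N : ReLUNet n L) (z : Pattern n L) (x : Fin (n 0) → ℝ) (l : ℕ)
    (i : Fin (n (l + 1))) : ℝ :=
  N.W l i ⬝ᵥ N.hgate z x l + N.b l i

/-- Gated network output `f_z(x)`. -/
def fgate (N : ReLUNet n L) (z : Pattern n L) (x : Fin (n 0) → ℝ) : ℝ :=
  N.wOut ⬝ᵥ N.hgate z x L + N.bOut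

/-- The linear region `R_z`. -/
def Region (N : ReLUNet n L) (z : Pattern n L) : Set (Fin (n 0) → ℝ) :=
  {x | ∀ (l : Fin L) (i : Fin (n (l.val + 1))),
    (z l i = true → 0 ≤ N.ggate z x l.val i) ∧
    (z l i = false → N.ggate z x l.val i ≤ 0)}

/-- `x` is non-binding: no hidden preactivation vanishes at `x`. -/
def NonBinding (N : ReLUNet n L) (x : Fin (n 0) → ℝ) : Prop :=
  ∀ (l : Fin L) (i : Fin (n (l.val + 1))), N.gact x l.val i ≠ 0

/-- The activation pattern of `x`: `z^l_i = 1` iff `g^l_i(x) ≥ 0`. -/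
noncomputable def patternOf (N : ReLUNet n L) (x : Fin (n 0) → ℝ) : Pattern n L :=
  fun l i => decide (0 ≤ N.gact x l.val i)

/-- The activation pattern of `x` with strict signs: `z(x)^l_i = 1` iff `g^l_i(x) > 0`. -/
noncomputable def posPattern (N : ReLUNet n L) (x : Fin (n 0) → ℝ) : Pattern n L :=
  fun l i => decide (0 < N.gact x l.val i)

/-- The matrix product `D(z^l) W^l ⋯ D(z^1) W^1`. -/
def gateMat (N : ReLUNet n L) (z : Pattern n L) :
    (l : ℕ) → Matrix (Fin (n l)) (Fin (n 0)) ℝ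
  | 0 => 1
  | l + 1 =>
      Matrix.diagonal (fun i => if patExt z l i then (1 : ℝ) else 0) *
        (N.W l * N.gateMat z l)

/-- The row vector `T(z) = W^{L+1} D(z^L) W^L ⋯ D(z^1) W^1`. -/
def Tz (N : ReLUNet n L) (z : Pattern n L) : Fin (n 0) → ℝ :=
  Matrix.vecMul N.wOut (N.gateMat z L)

end ReLUNet

/-- The Euclidean norm on `ℝ^m` (as plain functions). -/
noncomputable def euclNorm {m : ℕ} (v : Fin m → ℝ) : ℝ :=
  Real.sqrt (∑ j, v j ^ 2)


/-- Feasibility for the LP obtained from the MILP by fixing the activation pattern. -/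
def LPFeasible {n : ℕ → ℕ} {L : ℕ} (N : ReLUNet n L) (z : ReLUNet.Pattern n L)
    (x : Fin (n 0) → ℝ) (G : ∀ l : Fin L, Fin (n (l.val + 1)) → ℝ)
    (H : ∀ l : ℕ, Fin (n l) → ℝ) : Prop :=
  H 0 = x ∧
  (∀ (l : Fin L) (i : Fin (n (l.val + 1))),
      G l i = N.W l.val i ⬝ᵥ H l.val + N.b l.val i) ∧
  (∀ (l : Fin L) (i : Fin (n (l.val + 1))), z l i = true → H (l.val + 1) i = G l i) ∧
  (∀ (l : Fin L) (i : Fin (n (l.val + 1))),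
      z l i = false → G l i ≤ 0 ∧ H (l.val + 1) i = 0) ∧
  (∀ (l : Fin L) (i : Fin (n (l.val + 1))), 0 ≤ H (l.val + 1) i)

theorem lp_aux_H {n : ℕ → ℕ} {L : ℕ} (N : ReLUNet n L) (z : ReLUNet.Pattern n L)
    (x : Fin (n 0) → ℝ) (G : ∀ l : Fin L, Fin (n (l.val + 1)) → ℝ)
    (H : ∀ l : ℕ, Fin (n l) → ℝ) (h : LPFeasible N z x G H) :
    ∀ l : ℕ, l ≤ L → H l = N.hgate z x l := by
  obtain ⟨h0, hG, h1, h2, h3⟩ := h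
  intro l
  induction l with
  | zero => intro _; simpa [ReLUNet.hgate] using h0
  | succ l ih =>
    intro hl
    have hl' : l < L := hl
    have e := ih hl'.le
    funext i
    have hg := hG ⟨l, hl'⟩ i
    simp only [ReLUNet.hgate, ReLUNet.patExt, hl', dite_true]
    cases hz : z ⟨l, hl'⟩ i with
    | true =>
      have := h1 ⟨l, hl'⟩ i hz
      simp only [if_true]
      rw [← e]
      exact this.trans hg
    | false => simpa using (h2 ⟨l, hl'⟩ i hz).2

theorem lp_aux_region {n : ℕ → ℕ} {L : ℕ} (N : ReLUNet n L) (z : ReLUNet.Pattern n L)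
    (x : Fin (n 0) → ℝ) (hx : x ∈ N.Region z) :
    ∀ l : ℕ, l ≤ L → N.hgate z x l = N.hout x l := by
  intro l
  induction l with
  | zero => intro _; simp [ReLUNet.hgate, ReLUNet.hout]
  | succ l ih =>
    intro hl
    have hl' : l < L := hl
    have e := ih hl'.le
    funext i
    have hr := hx ⟨l, hl'⟩ i
    simp only [ReLUNet.ggate] at hr
    simp only [ReLUNet.hgate, ReLUNet.hout, ReLUNet.patExt, hl', dite_true]
    rw [← e]
    cases hz : z ⟨l, hl'⟩ i with
    | true => simpa using hr.1 hz
    | false => simpa using hr.2 hz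

theorem lp_aux_G {n : ℕ → ℕ} {L : ℕ} (N : ReLUNet n L) (z : ReLUNet.Pattern n L)
    (x : Fin (n 0) → ℝ) (G : ∀ l : Fin L, Fin (n (l.val + 1)) → ℝ)
    (H : ∀ l : ℕ, Fin (n l) → ℝ) (h : LPFeasible N z x G H)
    (l : Fin L) (i : Fin (n (l.val + 1))) : G l i = N.ggate z x l.val i := by
  rw [h.2.1 l i, lp_aux_H N z x G H h l.val l.2.le]
  rfl

theorem lp_aux_mem {n : ℕ → ℕ} {L : ℕ} (N : ReLUNet n L) (z : ReLUNet.Pattern n L)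
    (x : Fin (n 0) → ℝ) (G : ∀ l : Fin L, Fin (n (l.val + 1)) → ℝ)
    (H : ∀ l : ℕ, Fin (n l) → ℝ) (h : LPFeasible N z x G H) : x ∈ N.Region z := by
  intro l i
  rw [← lp_aux_G N z x G H h l i]
  obtain ⟨h0, hG, h1, h2, h3⟩ := h
  exact ⟨fun hz => h1 l i hz ▸ h3 l i, fun hz => (h2 l i hz).1⟩

/-- With the activation pattern fixed to `z'`, the point `x` admits
feasible `(G, H)` iff `x ∈ R_{z'}`; in that case the values are uniquely determined (they
equal the gated network values) and the objective equals `f_{z'}(x) = f(x)`. -/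
theorem lp_region_characterization {n : ℕ → ℕ} {L : ℕ} (hL : 1 ≤ L)
    (N : ReLUNet n L) (z' : ReLUNet.Pattern n L) (x : Fin (n 0) → ℝ) :
    ((∃ G H, LPFeasible N z' x G H) ↔ x ∈ N.Region z') ∧
    (∀ G H, LPFeasible N z' x G H →
        (∀ (l : Fin L) (i : Fin (n (l.val + 1))), G l i = N.ggate z' x l.val i) ∧
        (∀ l : ℕ, l ≤ L → ∀ i : Fin (n l), H l i = N.hgate z' x l i) ∧
        N.wOut ⬝ᵥ H L + N.bOut = N.fgate z' x ∧
        N.fgate z' x = N.f x) := by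
  refine ⟨⟨fun ⟨G, H, h⟩ => lp_aux_mem N z' x G H h, fun hx => ?_⟩, fun G H h => ?_⟩
  · refine ⟨fun l i => N.ggate z' x l.val i, N.hgate z' x, rfl, fun _ _ => rfl, ?_, ?_, ?_⟩
    · intro l i hz
      simp [ReLUNet.hgate, ReLUNet.patExt, ReLUNet.ggate, hz]
    · intro l i hz
      exact ⟨(hx l i).2 hz, by simp [ReLUNet.hgate, ReLUNet.patExt, hz]⟩
    · intro l i
      rw [lp_aux_region N z' x hx (l.val + 1) l.2]
      exact le_max_left _ _
  · refine ⟨lp_aux_G N z' x G H h,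
      fun l hl i => congrFun (lp_aux_H N z' x G H h l hl) i, ?_, ?_⟩
    · rw [lp_aux_H N z' x G H h L le_rfl]
      rfl
    · rw [ReLUNet.fgate, lp_aux_region N z' x (lp_aux_mem N z' x G H h) L le_rfl]
      rfl
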